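/- Under the framework assumptions on the structure of the system and on the data, suppose λ₁ = 0 and u − u_∞ ∈ L²(0,+∞;H) for some u_∞ ∈ H, and let (y,μ) be a solution of the fractional Cahn–Hilliard system satisfying the global bounds y ∈ L∞(0,+∞;V_B^σ), ∂_t y ∈ L²(0,+∞;V_A^{−r}) (and ∂_t y ∈ L²(0,+∞;H) if τ > 0), A^rμ ∈ L²(0,+∞;H). Then for every T > 0 there exists a constant C_T, independent of the shift, such that for every s ≥ 0: ∫_s^{s+T} ( |(μ(t),1)| + ∫_Ω β̂(y(t)) )² dt ≤ C_T; consequently ∫_s^{s+T} ‖μ(t)‖²_{A,r} dt ≤ C_T for every s ≥ 0, where ‖v‖²_{A,r} = |(v,e₁)|² + ‖A^r v‖². -/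

import Mathlib

noncomputable section

open MeasureTheory Filter Topology RealInnerProductSpace Set ENNReal NNReal

namespace FracCH

/-- The ambient space `ℝ³`. -/
abbrev E3 := EuclideanSpace ℝ (Fin 3)

/-- Lebesgue measure restricted to `Om`. -/
abbrev mOm (Om : Set E3) : Measure E3 := volume.restrict Om

/-- The Hilbert space `H = L²(Om)`. -/
abbrev Hs (Om : Set E3) := MeasureTheory.Lp ℝ 2 (mOm Om)

/-- The fractional power (in the spectral sense) with exponent `ρ` of the operator whose
eigenvalues are `lam` and whose orthonormal eigenvectors are `e`. -/
def fracPow {Om : Set E3} (lam : ℕ → ℝ) (e : ℕ → Hs Om) (ρ : ℝ) (v : Hs Om) : Hs Om :=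
  ∑' j, ((lam j) ^ ρ * ⟪v, e j⟫) • e j

/-- Membership in the domain of the fractional power of exponent `ρ`. -/
def inDom {Om : Set E3} (lam : ℕ → ℝ) (e : ℕ → Hs Om) (ρ : ℝ) (v : Hs Om) : Prop :=
  Summable fun j => ((lam j) ^ ρ * ⟪v, e j⟫) ^ 2

/-- Mean value of `v` on `Om`. -/
def meanVal {Om : Set E3} (v : Hs Om) : ℝ := (∫ x, v x ∂(mOm Om)) / (volume Om).toReal

/-- Subdifferential of a convex function `b : ℝ → [0,+∞]`. -/
def subdiff (b : ℝ → ℝ≥0∞) (s : ℝ) : Set ℝ :=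
  {ξ | b s < ⊤ ∧ ∀ t : ℝ, ENNReal.ofReal ((b s).toReal + ξ * (t - s)) ≤ b t}

/-- Square of the graph norm of the domain of a fractional power. -/
def gnormSq {Om : Set E3} (lam : ℕ → ℝ) (e : ℕ → Hs Om) (ρ : ℝ) (v : Hs Om) : ℝ :=
  ‖v‖ ^ 2 + ‖fracPow lam e ρ v‖ ^ 2

/-- Square of the dual norm (the norm of `V_A^{-r}`) of a linear functional. -/
def dualNormSq {Om : Set E3} (lam : ℕ → ℝ) (e : ℕ → Hs Om) (ρ : ℝ)
    (f : Hs Om →ₗ[ℝ] ℝ) : ℝ :=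
  sSup {a : ℝ | ∃ v : Hs Om, inDom lam e ρ v ∧ gnormSq lam e ρ v ≤ 1 ∧ a = (f v) ^ 2}

/-- The inner product of the Hilbert space which is the domain of a fractional power
(e.g.`V_B^σ`). -/
def innerFrac {Om : Set E3} (lam : ℕ → ℝ) (e : ℕ → Hs Om) (ρ : ℝ) (a b : Hs Om) : ℝ :=
  ⟪a, b⟫ + ⟪fracPow lam e ρ a, fracPow lam e ρ b⟫

/-- The structural assumptions: `Om ⊂ ℝ³` is open, connected and bounded; `A` and `B` are
unbounded monotone selfadjoint operators with compact resolvents, described by their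
nondecreasing sequences of eigenvalues `lamA`, `lamB` (tending to `+∞`) and complete
orthonormal systems of eigenvectors `eA`, `eB`; `r, σ > 0`, `τ ∈ [0,1]`; either `λ₁ > 0`
or `0 = λ₁ < λ₂` with `e₁` constant; if `λ₁ = 0` the constants belong to `V_B^σ`. -/
def SettingHyps (Om : Set E3) (lamA lamB : ℕ → ℝ) (eA eB : ℕ → Hs Om)
    (r σ τ : ℝ) : Prop :=
  IsOpen Om ∧ IsConnected Om ∧ Bornology.IsBounded Om ∧
  (∀ j, 0 ≤ lamA j) ∧ (∀ j, 0 ≤ lamB j) ∧ Monotone lamA ∧ Monotone lamB ∧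
  Tendsto lamA atTop atTop ∧ Tendsto lamB atTop atTop ∧
  Orthonormal ℝ eA ∧ Orthonormal ℝ eB ∧
  (Submodule.span ℝ (Set.range eA)).topologicalClosure = ⊤ ∧
  (Submodule.span ℝ (Set.range eB)).topologicalClosure = ⊤ ∧
  0 < r ∧ 0 < σ ∧ τ ∈ Set.Icc (0:ℝ) 1 ∧
  (0 < lamA 0 ∨ (lamA 0 = 0 ∧ 0 < lamA 1 ∧ ∃ c : ℝ, ∀ᵐ x ∂(mOm Om), eA 0 x = c)) ∧
  (lamA 0 = 0 → ∀ c : ℝ, ∃ w : Hs Om, inDom lamB eB σ w ∧ (∀ᵐ x ∂(mOm Om), w x = c))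

/-- The assumptions on the nonlinearity `f = β̂ + π̂` and on the data `u`, `y₀`:
`β̂ : ℝ → [0,+∞]` is convex, l.s.c., with `β̂(0) = 0`; `π̂` is `C¹` with Lipschitz
continuous derivative `π`; the coercivity `liminf_{|s|→∞}(β̂(s)+π̂(s))/s² > 0` holds;
`u ∈ W^{1,1}_loc([0,∞);H)` with primitive representation by `u'` and `∂_t u ∈ L¹(0,∞;H)`;
`y₀ ∈ V_B^σ` with `β̂(y₀) ∈ L¹(Om)`; and if `λ₁ = 0` the mean of `y₀` lies in the
interior of `D(β)`. -/
def DataHyps (Om : Set E3) (lamA lamB : ℕ → ℝ) (eB : ℕ → Hs Om) (σ : ℝ)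
    (betah : ℝ → ℝ≥0∞) (pih piF : ℝ → ℝ) (Lpi : ℝ≥0)
    (u u' : ℝ → Hs Om) (y0 : Hs Om) : Prop :=
  (∀ a b t : ℝ, 0 ≤ t → t ≤ 1 →
    betah (t * a + (1 - t) * b) ≤ ENNReal.ofReal t * betah a + ENNReal.ofReal (1 - t) * betah b) ∧
  LowerSemicontinuous betah ∧ betah 0 = 0 ∧
  (∀ s, HasDerivAt pih (piF s) s) ∧ LipschitzWith Lpi piF ∧
  (∃ α : ℝ, 0 < α ∧ ∀ᶠ s : ℝ in Filter.comap (|·|) atTop,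
    ENNReal.ofReal (α * s ^ 2 - pih s) ≤ betah s) ∧
  IntegrableOn u' (Set.Ioi (0:ℝ)) ∧
  (∀ t : ℝ, 0 ≤ t → u t = u 0 + ∫ s in (0:ℝ)..t, u' s) ∧
  inDom lamB eB σ y0 ∧ (∫⁻ x, betah (y0 x) ∂(mOm Om)) < ⊤ ∧
  (lamA 0 = 0 → meanVal y0 ∈ interior {s : ℝ | (subdiff betah s).Nonempty})

/-- The notion of solution `(y, μ)` of the weak formulation of the fractional
Cahn--Hilliard system on the half line `t ≥ 0`.  Here `dy t ∈ V_A^{-r}` represents the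
time derivative `∂_t y(t)` (acting on test functions, and linked to `y` by the integral
identity `(y(t),v) = (y(0),v) + ∫_0^t ⟨∂_t y(s),v⟩ ds`), while `z` represents
`τ ∂_t y ∈ L²(0,T;H)`.  The requirements are the regularity
`y ∈ L^∞(0,T;V_B^σ)`, `∂_t y ∈ L²(0,T;V_A^{-r})`, `τ ∂_t y ∈ L²(0,T;H)`,
`μ ∈ L²(0,T;V_A^r)`, `β̂(y) ∈ L¹(Om×(0,T))` for every `T > 0`, the two variational
equations/inequalities for a.a. `t`, and the initial condition `y(0) = y₀`. -/
def IsSolution (Om : Set E3) (lamA lamB : ℕ → ℝ) (eA eB : ℕ → Hs Om) (r σ τ : ℝ)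
    (betah : ℝ → ℝ≥0∞) (piF : ℝ → ℝ) (u : ℝ → Hs Om) (y0 : Hs Om)
    (y μ : ℝ → Hs Om) (dy : ℝ → Hs Om →ₗ[ℝ] ℝ) (z : ℝ → Hs Om) : Prop :=
  AEStronglyMeasurable y (volume.restrict (Set.Ioi (0:ℝ))) ∧
  (∀ᵐ t ∂(volume.restrict (Set.Ioi (0:ℝ))), inDom lamB eB σ (y t)) ∧
  (∀ T : ℝ, 0 < T → ∃ C : ℝ,
    ∀ᵐ t ∂(volume.restrict (Set.Ioc (0:ℝ) T)), gnormSq lamB eB σ (y t) ≤ C) ∧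
  (∀ v : Hs Om, inDom lamA eA r v → ∀ T : ℝ, 0 < T →
    IntegrableOn (fun s => dy s v) (Set.Ioc (0:ℝ) T)) ∧
  (∀ v : Hs Om, inDom lamA eA r v → ∀ t : ℝ, 0 ≤ t →
    ⟪y t, v⟫ = ⟪y 0, v⟫ + ∫ s in (0:ℝ)..t, dy s v) ∧
  (∀ T : ℝ, 0 < T → IntegrableOn (fun t => dualNormSq lamA eA r (dy t)) (Set.Ioc (0:ℝ) T)) ∧
  AEStronglyMeasurable z (volume.restrict (Set.Ioi (0:ℝ))) ∧
  (∀ᵐ t ∂(volume.restrict (Set.Ioi (0:ℝ))), ∀ v : Hs Om, inDom lamA eA r v →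
    ⟪z t, v⟫ = τ * dy t v) ∧
  (∀ T : ℝ, 0 < T → IntegrableOn (fun t => ‖z t‖ ^ 2) (Set.Ioc (0:ℝ) T)) ∧
  AEStronglyMeasurable μ (volume.restrict (Set.Ioi (0:ℝ))) ∧
  (∀ᵐ t ∂(volume.restrict (Set.Ioi (0:ℝ))), inDom lamA eA r (μ t)) ∧
  (∀ T : ℝ, 0 < T → IntegrableOn (fun t => gnormSq lamA eA r (μ t)) (Set.Ioc (0:ℝ) T)) ∧
  (∀ T : ℝ, 0 < T → (∫⁻ t in Set.Ioc (0:ℝ) T, ∫⁻ x, betah (y t x) ∂(mOm Om)) < ⊤) ∧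
  (∀ᵐ t ∂(volume.restrict (Set.Ioi (0:ℝ))), ∀ v : Hs Om, inDom lamA eA r v →
    dy t v + ⟪fracPow lamA eA r (μ t), fracPow lamA eA r v⟫ = 0) ∧
  (∀ᵐ t ∂(volume.restrict (Set.Ioi (0:ℝ))), ∀ v : Hs Om,
    inDom lamB eB σ v → (∫⁻ x, betah (v x) ∂(mOm Om)) < ⊤ →
    ⟪z t, y t - v⟫
      + ⟪fracPow lamB eB σ (y t), fracPow lamB eB σ (y t) - fracPow lamB eB σ v⟫
      + (∫⁻ x, betah (y t x) ∂(mOm Om)).toReal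
      + ∫ x, (piF (y t x) - u t x) * (y t x - v x) ∂(mOm Om)
      ≤ ⟪μ t, y t - v⟫ + (∫⁻ x, betah (v x) ∂(mOm Om)).toReal) ∧
  y 0 = y0

/-- The ω-limit set of the trajectory `y`, in the weak topology of `V_B^σ`. -/
def omegaLimit {Om : Set E3} (lamB : ℕ → ℝ) (eB : ℕ → Hs Om) (σ : ℝ)
    (y : ℝ → Hs Om) : Set (Hs Om) :=
  {w | inDom lamB eB σ w ∧ ∃ tn : ℕ → ℝ, StrictMono tn ∧ (∀ n, 0 ≤ tn n) ∧
    Tendsto tn atTop atTop ∧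
    ∀ φ : Hs Om, inDom lamB eB σ φ →
      Tendsto (fun n => innerFrac lamB eB σ (y (tn n)) φ) atTop
        (nhds (innerFrac lamB eB σ w φ))}

section Spectral

variable {Om : Set E3} {lam : ℕ → ℝ} {e : ℕ → Hs Om} {ρ : ℝ}

lemma inner_fracPow (he : Orthonormal ℝ e)
    (hc : (Submodule.span ℝ (Set.range e)).topologicalClosure = ⊤)
    {v : Hs Om} (hv : inDom lam e ρ v) (j : ℕ) :
    ⟪fracPow lam e ρ v, e j⟫ = lam j ^ ρ * ⟪v, e j⟫ := by
  let b : HilbertBasis ℕ ℝ (Hs Om) := HilbertBasis.mk he hc.ge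
  have hb : ∀ i, b i = e i := fun i => by simp [b]
  have hmem : Memℓp (fun j => lam j ^ ρ * ⟪v, e j⟫) 2 := by
    refine memℓp_gen ?_
    simpa only [inDom, Real.norm_eq_abs, ENNReal.toReal_ofNat, Real.rpow_ofNat, sq_abs] using hv
  let f : lp (fun _ : ℕ => ℝ) 2 := ⟨_, hmem⟩
  have hf : fracPow lam e ρ v = b.repr.symm f := by
    refine HasSum.tsum_eq ?_
    simpa [hb, f] using b.hasSum_repr_symm f
  rw [hf, real_inner_comm, ← hb j, ← b.repr_apply_apply, LinearIsometryEquiv.apply_symm_apply]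
  simp [f, hb]

/-- Poincaré inequality for a fractional power whose kernel is spanned by the first
eigenvector. -/
lemma norm_sub_proj_le (he : Orthonormal ℝ e)
    (hc : (Submodule.span ℝ (Set.range e)).topologicalClosure = ⊤)
    (hmono : Monotone lam) (h1 : 0 < lam 1) (hρ : 0 < ρ)
    {v : Hs Om} (hv : inDom lam e ρ v) :
    ‖v - ⟪v, e 0⟫ • e 0‖ ≤ (lam 1 ^ ρ)⁻¹ * ‖fracPow lam e ρ v‖ := by
  let b : HilbertBasis ℕ ℝ (Hs Om) := HilbertBasis.mk he hc.ge
  have hb : ∀ i, b i = e i := fun i => by simp [b]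
  have hp : 0 < lam 1 ^ ρ := Real.rpow_pos_of_pos h1 ρ
  have hsum : ∀ x : Hs Om, HasSum (fun j => ⟪x, e j⟫ ^ 2) (‖x‖ ^ 2) := fun x => by
    have h := b.hasSum_inner_mul_inner x x
    simp only [hb, real_inner_self_eq_norm_sq] at h
    simpa only [real_inner_comm x, ← sq] using h
  have hle : ‖v - ⟪v, e 0⟫ • e 0‖ ^ 2 ≤ ((lam 1 ^ ρ)⁻¹ * ‖fracPow lam e ρ v‖) ^ 2 := by
    rw [mul_pow]
    refine hasSum_le (fun j => ?_) (hsum _) ((hsum (fracPow lam e ρ v)).mul_left _)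
    rw [inner_fracPow he hc hv, inner_sub_left, real_inner_smul_left, ← mul_pow]
    rcases Nat.eq_zero_or_pos j with rfl | hj
    · rw [real_inner_self_eq_norm_sq, he.1 0]
      rw [one_pow, mul_one, sub_self, zero_pow two_ne_zero]
      positivity
    · rw [he.2 hj.ne, mul_zero, sub_zero, ← mul_assoc]
      rw [mul_pow]
      refine le_mul_of_one_le_left (sq_nonneg _) (one_le_pow₀ ?_)
      rw [inv_mul_eq_div, one_le_div hp]
      exact Real.rpow_le_rpow h1.le (hmono hj) hρ.le
  exact le_of_sq_le_sq hle (by positivity)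

lemma inDom_basis (he : Orthonormal ℝ e) (j : ℕ) : inDom lam e ρ (e j) := by
  refine summable_of_ne_finset_zero (s := {j}) fun i hi => ?_
  have : j ≠ i := fun h => hi (by simp [h])
  simp [he.2 this]

lemma fracPow_basis_zero (he : Orthonormal ℝ e) (h0 : lam 0 = 0) (hρ : 0 < ρ) :
    fracPow lam e ρ (e 0) = 0 := by
  have : ∀ j, (lam j ^ ρ * ⟪e 0, e j⟫) • e j = 0 := fun j => by
    rcases Nat.eq_zero_or_pos j with rfl | hj
    · simp [h0, Real.zero_rpow hρ.ne']
    · simp [he.2 hj.ne]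
  simp [fracPow, this]

lemma eq_zero_of_inner_basis (he : Orthonormal ℝ e)
    (hc : (Submodule.span ℝ (Set.range e)).topologicalClosure = ⊤)
    {x : Hs Om} (hx : ∀ j, ⟪x, e j⟫ = 0) : x = 0 := by
  let b : HilbertBasis ℕ ℝ (Hs Om) := HilbertBasis.mk he hc.ge
  have h := b.hasSum_inner_mul_inner x x
  have hb : ∀ i, b i = e i := fun i => by simp [b]
  simp only [hb, hx, zero_mul] at h
  exact inner_self_eq_zero.1 (h.unique hasSum_zero)

end Spectral

section L2

variable {Om : Set E3}

lemma integrable_sq_coe (f : Hs Om) : Integrable (fun x => f x ^ 2) (mOm Om) := by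
  simpa using (Lp.memLp f).integrable_sq

lemma integral_sq_coe (f : Hs Om) : ∫ x, f x ^ 2 ∂(mOm Om) = ‖f‖ ^ 2 := by
  rw [← real_inner_self_eq_norm_sq, L2.inner_def]
  exact integral_congr_ae (.of_forall fun x => by simp [sq])

lemma inner_eq_of_ae_const {e : Hs Om} {c : ℝ} (hc : ∀ᵐ x ∂(mOm Om), e x = c) (f : Hs Om) :
    ⟪f, e⟫ = c * ∫ x, f x ∂(mOm Om) := by
  rw [L2.inner_def, ← integral_const_mul]
  refine integral_congr_ae ?_
  filter_upwards [hc] with x hx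
  simp [hx]

lemma abs_integral_perturbation_le [IsFiniteMeasure (mOm Om)] {p : ℝ → ℝ} {L : ℝ≥0}
    (hp : LipschitzWith L p) (f g w : Hs Om) :
    |∫ x, (p (f x) - g x) * (f x - w x) ∂(mOm Om)| ≤
      3 * (p 0 ^ 2 * (mOm Om).real univ + L ^ 2 * ‖f‖ ^ 2 + ‖g‖ ^ 2)
        + 2 * (‖f‖ ^ 2 + ‖w‖ ^ 2) := by
  have hf := integrable_sq_coe f
  have hg := integrable_sq_coe g
  have hw := integrable_sq_coe w
  have hk : Integrable (fun _ : E3 => p 0 ^ 2) (mOm Om) := integrable_const _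
  have hLf : Integrable (fun x => (L : ℝ) ^ 2 * f x ^ 2) (mOm Om) := hf.const_mul _
  have hkf : Integrable (fun x => p 0 ^ 2 + (L : ℝ) ^ 2 * f x ^ 2) (mOm Om) := hk.add hLf
  have hkfg : Integrable (fun x => p 0 ^ 2 + (L : ℝ) ^ 2 * f x ^ 2 + g x ^ 2) (mOm Om) :=
    hkf.add hg
  have hfw : Integrable (fun x => f x ^ 2 + w x ^ 2) (mOm Om) := hf.add hw
  have hG : Integrable (fun x => 3 * (p 0 ^ 2 + (L : ℝ) ^ 2 * f x ^ 2 + g x ^ 2)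
      + 2 * (f x ^ 2 + w x ^ 2)) (mOm Om) := (hkfg.const_mul 3).add (hfw.const_mul 2)
  have hb : ∀ x, ‖(p (f x) - g x) * (f x - w x)‖ ≤
      3 * (p 0 ^ 2 + L ^ 2 * f x ^ 2 + g x ^ 2) + 2 * (f x ^ 2 + w x ^ 2) := fun x => by
    have h1 : |p (f x) - p 0| ≤ L * |f x| := by
      simpa [Real.dist_eq] using hp.dist_le_mul (f x) 0
    have h2 : (p (f x) - p 0) ^ 2 ≤ L ^ 2 * f x ^ 2 := by
      rw [← sq_abs, ← sq_abs (f x), ← mul_pow]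
      exact pow_le_pow_left₀ (abs_nonneg _) h1 2
    rw [Real.norm_eq_abs, abs_le]
    set d := p (f x) - p 0 with hd
    have h3 : p (f x) = d + p 0 := by ring
    rw [h3]
    constructor
    · nlinarith [sq_nonneg (d + p 0 - g x + (f x - w x)), sq_nonneg (f x + w x),
        sq_nonneg (d - p 0), sq_nonneg (d + g x), sq_nonneg (p 0 + g x),
        sq_nonneg (d + p 0 - g x), sq_nonneg (f x - w x)]
    · nlinarith [sq_nonneg (d + p 0 - g x - (f x - w x)), sq_nonneg (f x + w x),
        sq_nonneg (d - p 0), sq_nonneg (d + g x), sq_nonneg (p 0 + g x),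
        sq_nonneg (d + p 0 - g x), sq_nonneg (f x - w x)]
  have h := norm_integral_le_of_norm_le hG (.of_forall hb)
  rw [Real.norm_eq_abs] at h
  refine h.trans_eq ?_
  rw [integral_add (hkfg.const_mul 3) (hfw.const_mul 2), integral_const_mul, integral_const_mul,
    integral_add hkf hg, integral_add hk hLf, integral_add hf hw, integral_const_mul,
    integral_sq_coe, integral_sq_coe, integral_sq_coe, integral_const]
  simp [mul_comm]

end L2

/-- A quantity controlled by an integrable function plus a constant is bounded in `L¹` on
windows of fixed length, uniformly in their position. -/
lemma exists_shift_bound {F g : ℝ → ℝ} {D : ℝ}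
    (hF : ∀ᵐ t ∂(volume.restrict (Ioi (0:ℝ))), F t ≤ D * (1 + g t)) (hD : 0 ≤ D)
    (hg0 : ∀ t, 0 ≤ g t) (hg : (∫⁻ t in Ioi (0:ℝ), ENNReal.ofReal (g t)) < ⊤) (T : ℝ) :
    ∃ C : ℝ, 0 ≤ C ∧ ∀ s : ℝ, 0 ≤ s →
      (∫⁻ t in Ioc s (s + T), ENNReal.ofReal (F t)) ≤ ENNReal.ofReal C := by
  set B : ℝ≥0∞ := ENNReal.ofReal D * (ENNReal.ofReal T + ∫⁻ t in Ioi (0:ℝ), ENNReal.ofReal (g t))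
    with hB
  have hBt : B ≠ ⊤ := ENNReal.mul_ne_top ofReal_ne_top (ENNReal.add_ne_top.2 ⟨ofReal_ne_top, hg.ne⟩)
  refine ⟨B.toReal, toReal_nonneg, fun s hs => ?_⟩
  rw [ENNReal.ofReal_toReal hBt]
  have hsub : Ioc s (s + T) ⊆ Ioi (0:ℝ) := fun t ht => hs.trans_lt ht.1
  calc (∫⁻ t in Ioc s (s + T), ENNReal.ofReal (F t))
      ≤ ∫⁻ t in Ioc s (s + T), ENNReal.ofReal D * (1 + ENNReal.ofReal (g t)) := by
        refine lintegral_mono_ae ?_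
        filter_upwards [ae_restrict_of_ae_restrict_of_subset hsub hF] with t ht
        refine (ENNReal.ofReal_le_ofReal ht).trans_eq ?_
        rw [ENNReal.ofReal_mul hD, ENNReal.ofReal_add zero_le_one (hg0 t), ENNReal.ofReal_one]
    _ = ENNReal.ofReal D * (ENNReal.ofReal T + ∫⁻ t in Ioc s (s + T), ENNReal.ofReal (g t)) := by
        rw [lintegral_const_mul' _ _ ofReal_ne_top, lintegral_add_left measurable_const]
        simp
    _ ≤ B := by
        rw [hB]
        gcongr

lemma norm_le_of_primitive {E : Type*} [NormedAddCommGroup E] [NormedSpace ℝ E] {u u' : ℝ → E}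
    (hu' : IntegrableOn u' (Ioi (0:ℝ)))
    (hu : ∀ t : ℝ, 0 ≤ t → u t = u 0 + ∫ s in (0:ℝ)..t, u' s) {t : ℝ} (ht : 0 ≤ t) :
    ‖u t‖ ≤ ‖u 0‖ + ∫ s in Ioi (0:ℝ), ‖u' s‖ := by
  rw [hu t ht, intervalIntegral.integral_of_le ht]
  refine (norm_add_le _ _).trans ?_
  gcongr
  refine (norm_integral_le_integral_norm _).trans ?_
  exact setIntegral_mono_set hu'.norm (.of_forall fun _ => norm_nonneg _)
    (Ioc_subset_Ioi_self).eventuallyLE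

/-- Testing the variational inequality with a constant function controls the potential energy
and the mean of the chemical potential. -/
lemma exists_test_bound {Om : Set E3} [IsFiniteMeasure (mOm Om)] {lamA lamB : ℕ → ℝ}
    {eA eB : ℕ → Hs Om} {r σ c a : ℝ} {p : ℝ → ℝ} {L : ℝ≥0}
    (hV : 0 < (volume Om).toReal)
    (he : Orthonormal ℝ eA) (hcl : (Submodule.span ℝ (Set.range eA)).topologicalClosure = ⊤)
    (hmono : Monotone lamA) (h1 : 0 < lamA 1) (hr : 0 < r)
    (hc : ∀ᵐ x ∂(mOm Om), eA 0 x = c) (hp : LipschitzWith L p)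
    {W : Hs Om} (hW : ∀ᵐ x ∂(mOm Om), W x = a) (y0 : Hs Om) (C N k : ℝ) :
    ∃ K : ℝ, 0 ≤ K ∧ ∀ (Y M Z U : Hs Om) (b : ℝ), inDom lamA eA r M →
      gnormSq lamB eB σ Y ≤ C → ‖U‖ ≤ N → ⟪Y, eA 0⟫ = ⟪y0, eA 0⟫ →
      ⟪Z, Y - W⟫ + ⟪fracPow lamB eB σ Y, fracPow lamB eB σ Y - fracPow lamB eB σ W⟫ + b
        + ∫ x, (p (Y x) - U x) * (Y x - W x) ∂(mOm Om) ≤ ⟪M, Y - W⟫ + k →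
      b - (meanVal y0 - a) * ∫ x, M x ∂(mOm Om)
        ≤ K * (1 + ‖Z‖ + ‖fracPow lamA eA r M‖) := by
  set S : ℝ := √C + ‖W‖ with hS
  set Q : ℝ := 3 * (p 0 ^ 2 * (mOm Om).real univ + L ^ 2 * C + N ^ 2) + 2 * (C + ‖W‖ ^ 2) with hQ
  set κ : ℝ := (lamA 1 ^ r)⁻¹ with hκ
  have hκ0 : 0 ≤ κ := by positivity
  have hS0 : 0 ≤ S := by positivity
  refine ⟨S + √C * ‖fracPow lamB eB σ W‖ + |Q| + κ * S + |k|, by positivity, ?_⟩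
  intro Y M Z U b hM hY hU hYe hineq
  rw [gnormSq] at hY
  have hY2 : ‖Y‖ ^ 2 ≤ C := by nlinarith [sq_nonneg ‖fracPow lamB eB σ Y‖]
  have hBY : ‖fracPow lamB eB σ Y‖ ≤ √C :=
    Real.le_sqrt_of_sq_le (by nlinarith [sq_nonneg ‖Y‖])
  have hYW : ‖Y - W‖ ≤ S := (norm_sub_le _ _).trans
    (add_le_add_left (Real.le_sqrt_of_sq_le hY2) _)
  have hZ : |⟪Z, Y - W⟫| ≤ ‖Z‖ * S := (abs_real_inner_le_norm _ _).trans (by gcongr)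
  have hB : -(√C * ‖fracPow lamB eB σ W‖)
      ≤ ⟪fracPow lamB eB σ Y, fracPow lamB eB σ Y - fracPow lamB eB σ W⟫ := by
    rw [inner_sub_right, real_inner_self_eq_norm_sq]
    have h2 : ‖fracPow lamB eB σ Y‖ * ‖fracPow lamB eB σ W‖ ≤ √C * ‖fracPow lamB eB σ W‖ := by
      gcongr
    nlinarith [real_inner_le_norm (fracPow lamB eB σ Y) (fracPow lamB eB σ W),
      sq_nonneg ‖fracPow lamB eB σ Y‖]
  have hP : |∫ x, (p (Y x) - U x) * (Y x - W x) ∂(mOm Om)| ≤ Q :=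
    (abs_integral_perturbation_le hp Y U W).trans (by rw [hQ]; gcongr)
  have hA : |⟪M - ⟪M, eA 0⟫ • eA 0, Y - W⟫| ≤ κ * ‖fracPow lamA eA r M‖ * S :=
    (abs_real_inner_le_norm _ _).trans
      (mul_le_mul (norm_sub_proj_le he hcl hmono h1 hr hM) hYW (norm_nonneg _) (by positivity))
  have hWe : ⟪W, eA 0⟫ = c * (a * (volume Om).toReal) := by
    rw [inner_eq_of_ae_const hc, integral_congr_ae hW, integral_const]
    simp [Measure.real, mul_comm]
  have hcV : c ^ 2 * (volume Om).toReal = 1 := by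
    have h := inner_eq_of_ae_const hc (eA 0)
    rw [real_inner_self_eq_norm_sq, he.1 0, integral_congr_ae hc, integral_const] at h
    simp only [Measure.real, Measure.restrict_apply_univ, smul_eq_mul] at h
    linarith
  have hmain : ⟪M, Y - W⟫ = ⟪M - ⟪M, eA 0⟫ • eA 0, Y - W⟫
      + (meanVal y0 - a) * ∫ x, M x ∂(mOm Om) := by
    have h1 : ⟪eA 0, Y - W⟫ = c * ((meanVal y0 - a) * (volume Om).toReal) := by
      rw [real_inner_comm, inner_sub_left, hYe, hWe, inner_eq_of_ae_const hc, meanVal, sub_mul,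
        div_mul_cancel₀ _ hV.ne']
      ring
    rw [inner_sub_left, real_inner_smul_left, h1, inner_eq_of_ae_const hc M]
    linear_combination ((meanVal y0 - a) * ∫ x, M x ∂(mOm Om)) * hcV
  calc b - (meanVal y0 - a) * ∫ x, M x ∂(mOm Om)
      ≤ ‖Z‖ * S + √C * ‖fracPow lamB eB σ W‖ + |Q| + κ * ‖fracPow lamA eA r M‖ * S + |k| := by
        linarith [neg_abs_le ⟪Z, Y - W⟫, le_abs_self ⟪M - ⟪M, eA 0⟫ • eA 0, Y - W⟫,
          neg_abs_le (∫ x, (p (Y x) - U x) * (Y x - W x) ∂(mOm Om)), le_abs_self Q,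
          le_abs_self k]
    _ ≤ _ := by
        rw [← sub_nonneg]
        have h : 0 ≤ S + κ * S + S * ‖fracPow lamA eA r M‖ + κ * S * ‖Z‖
            + (√C * ‖fracPow lamB eB σ W‖ + |Q| + |k|) * (‖Z‖ + ‖fracPow lamA eA r M‖) := by
          positivity
        refine h.trans_eq ?_
        ring

/-- The mean of a solution is conserved. -/
lemma inner_basis_zero_eq {Om : Set E3} {lamA : ℕ → ℝ} {eA : ℕ → Hs Om} {r : ℝ}
    {y μ : ℝ → Hs Om} {dy : ℝ → Hs Om →ₗ[ℝ] ℝ}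
    (he : Orthonormal ℝ eA) (h0 : lamA 0 = 0) (hr : 0 < r)
    (hy : ∀ v : Hs Om, inDom lamA eA r v → ∀ t : ℝ, 0 ≤ t →
      ⟪y t, v⟫ = ⟪y 0, v⟫ + ∫ s in (0:ℝ)..t, dy s v)
    (hdy : ∀ᵐ t ∂(volume.restrict (Set.Ioi (0:ℝ))), ∀ v : Hs Om, inDom lamA eA r v →
      dy t v + ⟪fracPow lamA eA r (μ t), fracPow lamA eA r v⟫ = 0) {t : ℝ} (ht : 0 ≤ t) :
    ⟪y t, eA 0⟫ = ⟪y 0, eA 0⟫ := by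
  rw [hy _ (inDom_basis he 0) t ht, intervalIntegral.integral_of_le ht]
  rw [add_eq_left]
  refine integral_eq_zero_of_ae ?_
  filter_upwards [ae_restrict_of_ae_restrict_of_subset Ioc_subset_Ioi_self hdy] with s hs
  simpa [fracPow_basis_zero he h0 hr] using hs _ (inDom_basis he 0)

/-- **Shift-uniform estimates in the case `λ₁ = 0`.** Under the structural assumptions
and the assumptions on the data, with `λ₁ = 0` and `u - u_∞ ∈ L²(0,+∞;H)`, let `(y, μ)`
be a solution satisfying the global bounds.  Then for every `T > 0` there is a constant
`C_T`, independent of the shift `s ≥ 0`, bounding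
`∫_s^{s+T} (|(μ(t),1)| + ∫_Om β̂(y(t)))² dt` and consequently
`∫_s^{s+T} ‖μ(t)‖²_{A,r} dt`, where `‖v‖²_{A,r} = |(v,e₁)|² + ‖A^r v‖²`. -/
theorem shift_uniform_estimates
    (Om : Set E3) (lamA lamB : ℕ → ℝ) (eA eB : ℕ → Hs Om) (r σ τ : ℝ)
    (betah : ℝ → ℝ≥0∞) (pih piF : ℝ → ℝ) (Lpi : ℝ≥0)
    (u u' : ℝ → Hs Om) (y0 : Hs Om)
    (hset : SettingHyps Om lamA lamB eA eB r σ τ)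
    (hdata : DataHyps Om lamA lamB eB σ betah pih piF Lpi u u' y0)
    (hlam : lamA 0 = 0)
    (uinf : Hs Om) (hui : IntegrableOn (fun t => ‖u t - uinf‖ ^ 2) (Set.Ioi (0:ℝ)))
    (y μ : ℝ → Hs Om) (dy : ℝ → Hs Om →ₗ[ℝ] ℝ) (z : ℝ → Hs Om)
    (hsol : IsSolution Om lamA lamB eA eB r σ τ betah piF u y0 y μ dy z)
    (hyG : ∃ C : ℝ, ∀ᵐ t ∂(volume.restrict (Set.Ioi (0:ℝ))), gnormSq lamB eB σ (y t) ≤ C)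
    (hdyG : (∫⁻ t in Set.Ioi (0:ℝ), ENNReal.ofReal (dualNormSq lamA eA r (dy t))) < ⊤)
    (hArG : (∫⁻ t in Set.Ioi (0:ℝ), ENNReal.ofReal (‖fracPow lamA eA r (μ t)‖ ^ 2)) < ⊤)
    (hzG : 0 < τ → (∫⁻ t in Set.Ioi (0:ℝ), ENNReal.ofReal (‖z t‖ ^ 2)) < ⊤) :
    ∀ T : ℝ, 0 < T → ∃ CT : ℝ, ∀ s : ℝ, 0 ≤ s →
      (∫⁻ t in Set.Ioc s (s + T),
          ENNReal.ofReal ((|∫ x, μ t x ∂(mOm Om)|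
            + (∫⁻ x, betah (y t x) ∂(mOm Om)).toReal) ^ 2))
        ≤ ENNReal.ofReal CT ∧
      (∫⁻ t in Set.Ioc s (s + T),
          ENNReal.ofReal (⟪μ t, eA 0⟫ ^ 2 + ‖fracPow lamA eA r (μ t)‖ ^ 2))
        ≤ ENNReal.ofReal CT := by
  obtain ⟨hopen, hconn, hbdd, -, -, hmonoA, -, -, -, heA, -, hclA, -, hr, -, hτ, hcase, hconst⟩ :=
    hset
  obtain ⟨-, -, -, -, hLip, -, hu', hu, -, -, hmean⟩ := hdata
  obtain ⟨-, -, -, -, hyint, -, hzm, hz, -, -, hμdom, -, -, heq, hvi, hy00⟩ := hsol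
  obtain ⟨C, hC⟩ := hyG
  obtain ⟨-, hlam1, c, hc⟩ := hcase.resolve_left (by simp [hlam])
  have hVtop : volume Om < ⊤ := hbdd.measure_lt_top
  have : IsFiniteMeasure (mOm Om) := ⟨by simpa using hVtop⟩
  have hV : 0 < (volume Om).toReal :=
    ENNReal.toReal_pos (hopen.measure_pos volume hconn.nonempty).ne' hVtop.ne
  have hzfin : (∫⁻ t in Ioi (0:ℝ), ENNReal.ofReal (‖z t‖ ^ 2)) < ⊤ := by
    rcases hτ.1.lt_or_eq with h | h
    · exact hzG h
    · have : ∀ᵐ t ∂(volume.restrict (Ioi (0:ℝ))), ENNReal.ofReal (‖z t‖ ^ 2) = 0 := by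
        filter_upwards [hz] with t ht
        have : z t = 0 := eq_zero_of_inner_basis heA hclA fun j => by
          rw [ht _ (inDom_basis heA j), ← h, zero_mul]
        simp [this]
      rw [lintegral_congr_ae this]
      simp
  have hsumfin : (∫⁻ t in Ioi (0:ℝ),
      ENNReal.ofReal (‖z t‖ ^ 2 + ‖fracPow lamA eA r (μ t)‖ ^ 2)) < ⊤ := by
    have : ∀ t, ENNReal.ofReal (‖z t‖ ^ 2 + ‖fracPow lamA eA r (μ t)‖ ^ 2)
        = ENNReal.ofReal (‖z t‖ ^ 2) + ENNReal.ofReal (‖fracPow lamA eA r (μ t)‖ ^ 2) :=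
      fun t => ENNReal.ofReal_add (sq_nonneg _) (sq_nonneg _)
    simp_rw [this]
    rw [lintegral_add_left' (hzm.norm.aemeasurable.pow_const 2).ennreal_ofReal]
    exact ENNReal.add_lt_top.2 ⟨hzfin, hArG⟩
  obtain ⟨δ, hδ, hδm⟩ : ∃ δ > 0, ∀ a, |a - meanVal y0| ≤ δ → betah a < ⊤ := by
    obtain ⟨ε, hε, hball⟩ := Metric.mem_nhds_iff.1 (mem_interior_iff_mem_nhds.1 (hmean hlam))
    refine ⟨ε / 2, by positivity, fun a ha => ?_⟩
    obtain ⟨ξ, hξ⟩ := hball (show a ∈ Metric.ball (meanVal y0) ε by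
      rw [Metric.mem_ball, Real.dist_eq]; linarith)
    exact hξ.1
  have key : ∀ a, |a - meanVal y0| ≤ δ → ∃ K : ℝ, 0 ≤ K ∧
      ∀ᵐ t ∂(volume.restrict (Ioi (0:ℝ))),
        (∫⁻ x, betah (y t x) ∂(mOm Om)).toReal - (meanVal y0 - a) * ∫ x, μ t x ∂(mOm Om)
          ≤ K * (1 + ‖z t‖ + ‖fracPow lamA eA r (μ t)‖) := by
    intro a ha
    obtain ⟨W, hWdom, hW⟩ := hconst hlam a
    have hWfin : (∫⁻ x, betah (W x) ∂(mOm Om)) < ⊤ := by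
      have h : (fun x => betah (W x)) =ᵐ[mOm Om] fun _ => betah a := by
        filter_upwards [hW] with x hx
        rw [hx]
      rw [lintegral_congr_ae h, lintegral_const]
      exact ENNReal.mul_lt_top (hδm a ha) (measure_lt_top _ _)
    obtain ⟨K, hK0, hK⟩ := exists_test_bound (lamB := lamB) (eB := eB) (σ := σ) hV heA hclA hmonoA
      hlam1 hr hc hLip hW y0 C (‖u 0‖ + ∫ s in Ioi (0:ℝ), ‖u' s‖)
      (∫⁻ x, betah (W x) ∂(mOm Om)).toReal
    refine ⟨K, hK0, ?_⟩
    filter_upwards [hμdom, hC, hvi, ae_restrict_mem measurableSet_Ioi] with t h1 h2 h3 h4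
    have ht : 0 ≤ t := le_of_lt h4
    refine hK (y t) (μ t) (z t) (u t) _ h1 h2 (norm_le_of_primitive hu' hu ht) ?_
      (h3 W hWdom hWfin)
    rw [inner_basis_zero_eq heA hlam hr hyint heq ht, hy00]
  obtain ⟨K₁, hK₁, hk₁⟩ := key (meanVal y0 + δ) (by simp [abs_of_pos hδ])
  obtain ⟨K₂, hK₂, hk₂⟩ := key (meanVal y0 - δ) (by simp [abs_of_pos hδ])
  set K : ℝ := (1 + 1 / δ) * (K₁ + K₂) with hKdef
  have hmain : ∀ᵐ t ∂(volume.restrict (Ioi (0:ℝ))),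
      (|∫ x, μ t x ∂(mOm Om)| + (∫⁻ x, betah (y t x) ∂(mOm Om)).toReal) ^ 2
        ≤ 3 * K ^ 2 * (1 + (‖z t‖ ^ 2 + ‖fracPow lamA eA r (μ t)‖ ^ 2)) := by
    filter_upwards [hk₁, hk₂] with t h₁ h₂
    set I := ∫ x, μ t x ∂(mOm Om)
    set b := (∫⁻ x, betah (y t x) ∂(mOm Om)).toReal with hb
    have hb0 : 0 ≤ b := toReal_nonneg
    set R := 1 + ‖z t‖ + ‖fracPow lamA eA r (μ t)‖ with hR
    have hR0 : 0 ≤ R := by positivity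
    have h3 : b + δ * |I| ≤ (K₁ + K₂) * R := by
      rcases abs_cases I with ⟨h, -⟩ | ⟨h, -⟩ <;> rw [h] <;>
        nlinarith [mul_nonneg hK₁ hR0, mul_nonneg hK₂ hR0]
    have h4 : |I| + b ≤ K * R := by
      have h5 : |I| + b ≤ (1 + 1 / δ) * (b + δ * |I|) := by
        have : (1 + 1 / δ) * (b + δ * |I|) = |I| + b + (b / δ + δ * |I|) := by
          field_simp
          ring
        rw [this]
        have : 0 ≤ b / δ + δ * |I| := by positivity
        linarith
      rw [hKdef, mul_assoc]
      exact h5.trans (by gcongr)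
    calc (|I| + b) ^ 2 ≤ (K * R) ^ 2 := pow_le_pow_left₀ (by positivity) h4 2
      _ = K ^ 2 * R ^ 2 := mul_pow _ _ _
      _ ≤ K ^ 2 * (3 * (1 + (‖z t‖ ^ 2 + ‖fracPow lamA eA r (μ t)‖ ^ 2))) := by
          gcongr
          rw [hR]
          nlinarith [sq_nonneg (1 - ‖z t‖), sq_nonneg (1 - ‖fracPow lamA eA r (μ t)‖),
            sq_nonneg (‖z t‖ - ‖fracPow lamA eA r (μ t)‖)]
      _ = _ := by ring
  have hsecond : ∀ᵐ t ∂(volume.restrict (Ioi (0:ℝ))),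
      ⟪μ t, eA 0⟫ ^ 2 + ‖fracPow lamA eA r (μ t)‖ ^ 2
        ≤ (c ^ 2 * (3 * K ^ 2) + 1)
          * (1 + (‖z t‖ ^ 2 + ‖fracPow lamA eA r (μ t)‖ ^ 2)) := by
    filter_upwards [hmain] with t ht
    rw [inner_eq_of_ae_const hc, mul_pow, add_mul, one_mul, mul_assoc (c ^ 2)]
    refine add_le_add ?_ (by nlinarith [sq_nonneg ‖z t‖])
    refine mul_le_mul_of_nonneg_left (le_trans ?_ ht) (sq_nonneg c)
    rw [← sq_abs]
    exact pow_le_pow_left₀ (abs_nonneg _) (le_add_of_nonneg_right toReal_nonneg) 2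
  intro T _
  obtain ⟨C₁, hC₁, h₁⟩ := exists_shift_bound hmain (by positivity) (fun t => by positivity)
    hsumfin T
  obtain ⟨C₂, hC₂, h₂⟩ := exists_shift_bound hsecond (by positivity) (fun t => by positivity)
    hsumfin T
  exact ⟨C₁ + C₂, fun s hs =>
    ⟨(h₁ s hs).trans (ENNReal.ofReal_le_ofReal (by linarith)),
      (h₂ s hs).trans (ENNReal.ofReal_le_ofReal (by linarith))⟩⟩

end FracCH
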